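/- Let n ≥ 1 and let ρ be a Z-retraction of [0,1]ⁿ whose range P = R_ρ is a closed domain. Then there exists a Z-retraction ρ' of [0,1]ⁿ with range P such that P is the unique Z-homeomorphism domain for ρ'; i.e., the retract A_{ρ'} (which is isomorphic to A_ρ) has multiplicity 1. -/

import Mathlib

open Set MeasureTheory

/-- The unit cube `[0,1]^n` in `ℝ^n`. -/
def cubeSet (n : ℕ) : Set (Fin n → ℝ) := Set.Icc 0 1

/-- A point all of whose coordinates are rational. -/
def IsRationalPoint {n : ℕ} (v : Fin n → ℝ) : Prop := ∀ i, ∃ q : ℚ, v i = (q : ℝ)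

/-- A rational polyhedron: a finite union of convex hulls of finite sets of rational points. -/
def IsRationalPolyhedron {n : ℕ} (P : Set (Fin n → ℝ)) : Prop :=
  ∃ S : Finset (Finset (Fin n → ℝ)),
    (∀ F ∈ S, ∀ v ∈ F, IsRationalPoint v) ∧
    P = ⋃ F ∈ S, convexHull ℝ (F : Set (Fin n → ℝ))

/-- An affine map `x ↦ Mx + b` with integer matrix `M` and integer vector `b`. -/
def IsIntAffine {n m : ℕ} (g : (Fin n → ℝ) → (Fin m → ℝ)) : Prop :=
  ∃ (M : Fin m → Fin n → ℤ) (b : Fin m → ℤ),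
    ∀ x i, g x i = (∑ j, (M i j : ℝ) * x j) + (b i : ℝ)

/-- A Z-map on `P`: continuous on `P`, with finitely many integer affine pieces. -/
def IsZMapOn {n m : ℕ} (P : Set (Fin n → ℝ)) (f : (Fin n → ℝ) → (Fin m → ℝ)) : Prop :=
  ContinuousOn f P ∧
  ∃ (k : ℕ) (g : Fin k → (Fin n → ℝ) → (Fin m → ℝ)),
    (∀ i, IsIntAffine (g i)) ∧ ∀ x ∈ P, ∃ i, f x = g i x

/-- `f` restricted to `P` is a Z-homeomorphism of `P` onto `Q`. -/
def IsZHomeoOnto {n m : ℕ} (P : Set (Fin n → ℝ)) (Q : Set (Fin m → ℝ))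
    (f : (Fin n → ℝ) → (Fin m → ℝ)) : Prop :=
  IsZMapOn P f ∧ f '' P = Q ∧ Set.InjOn f P ∧
  ∃ g : (Fin m → ℝ) → (Fin n → ℝ),
    IsZMapOn Q g ∧ (∀ x ∈ P, g (f x) = x) ∧ (∀ y ∈ Q, f (g y) = y)

/-- A Z-retraction of the cube `[0,1]^n`. -/
def IsZRetraction {n : ℕ} (σ : (Fin n → ℝ) → (Fin n → ℝ)) : Prop :=
  IsZMapOn (cubeSet n) σ ∧ Set.MapsTo σ (cubeSet n) (cubeSet n) ∧
  ∀ x ∈ cubeSet n, σ (σ x) = σ x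

/-- The range `R_σ = σ([0,1]^n)` of a Z-retraction. -/
def zRange {n : ℕ} (σ : (Fin n → ℝ) → (Fin n → ℝ)) : Set (Fin n → ℝ) := σ '' cubeSet n

/-- A Z-homeomorphism domain for `σ`: a rational polyhedron `Q ⊆ [0,1]^n` such that
`σ` restricted to `Q` is a Z-homeomorphism of `Q` onto `R_σ`. -/
def IsZHomeoDomain {n : ℕ} (σ : (Fin n → ℝ) → (Fin n → ℝ)) (Q : Set (Fin n → ℝ)) : Prop :=
  IsRationalPolyhedron Q ∧ Q ⊆ cubeSet n ∧ IsZHomeoOnto Q (zRange σ) σ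

/-- A (Kuratowski) closed domain: `D` equals the closure of its interior. -/
def IsClosedDomain {n : ℕ} (D : Set (Fin n → ℝ)) : Prop :=
  closure (interior D) = D

/-- A scalar integer affine map. -/
def IsIntAffine1 {n : ℕ} (g : (Fin n → ℝ) → ℝ) : Prop :=
  ∃ (m : Fin n → ℤ) (b : ℤ), ∀ x, g x = (∑ j, (m j : ℝ) * x j) + (b : ℝ)

/-- A scalar Z-map on `P`. -/
def IsZMapOn1 {n : ℕ} (P : Set (Fin n → ℝ)) (f : (Fin n → ℝ) → ℝ) : Prop :=
  ContinuousOn f P ∧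
  ∃ (k : ℕ) (g : Fin k → (Fin n → ℝ) → ℝ),
    (∀ i, IsIntAffine1 (g i)) ∧ ∀ x ∈ P, ∃ i, f x = g i x

/-- The free MV-algebra `McN([0,1]^n)`, viewed as a set of functions on the cube. -/
def McN (n : ℕ) : Set (↥(cubeSet n) → ℝ) :=
  { f | (∀ x, f x ∈ Set.Icc (0:ℝ) 1) ∧
    ∃ g : (Fin n → ℝ) → ℝ, IsZMapOn1 (cubeSet n) g ∧ ∀ x : ↥(cubeSet n), f x = g x.1 }

/-- Pointwise MV-sum `f ⊕ g = min(f + g, 1)`. -/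
def mvAdd {X : Type*} (f g : X → ℝ) : X → ℝ := fun x => min (f x + g x) 1

/-- Pointwise MV-negation `¬f = 1 - f`. -/
def mvNeg {X : Type*} (f : X → ℝ) : X → ℝ := fun x => 1 - f x

/-- The retract `A_σ = {g ∘ σ : g ∈ McN([0,1]^n)}` associated with a Z-retraction `σ`. -/
def retAlg {n : ℕ} (σ : (Fin n → ℝ) → (Fin n → ℝ)) : Set (↥(cubeSet n) → ℝ) :=
  { f | ∃ g ∈ McN n, ∀ (x : ↥(cubeSet n)) (h : σ x.1 ∈ cubeSet n), f x = g ⟨σ x.1, h⟩ }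

/-- `ε` is a retraction of `McN([0,1]^n)` onto `A`. -/
def IsMcNRetraction {n : ℕ} (ε : ↥(McN n) → ↥(McN n)) (A : Set (↥(cubeSet n) → ℝ)) : Prop :=
  (∀ (f g : ↥(McN n)) (h : mvAdd f.1 g.1 ∈ McN n),
      (ε ⟨mvAdd f.1 g.1, h⟩).1 = mvAdd (ε f).1 (ε g).1) ∧
  (∀ (f : ↥(McN n)) (h : mvNeg f.1 ∈ McN n),
      (ε ⟨mvNeg f.1, h⟩).1 = mvNeg (ε f).1) ∧
  (∀ f, ε (ε f) = ε f) ∧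
  Subtype.val '' Set.range ε = A

/-- An MV-isomorphism between two sets of `[0,1]`-valued functions. -/
def IsMVIsoFun {X Y : Type*} (A : Set (X → ℝ)) (B : Set (Y → ℝ)) (h : ↥A → ↥B) : Prop :=
  Function.Bijective h ∧
  (∀ (f g : ↥A) (hm : mvAdd f.1 g.1 ∈ A),
      (h ⟨mvAdd f.1 g.1, hm⟩).1 = mvAdd (h f).1 (h g).1) ∧
  (∀ (f : ↥A) (hm : mvNeg f.1 ∈ A),
      (h ⟨mvNeg f.1, hm⟩).1 = mvNeg (h f).1)

/-- The affine map `x ↦ Mx + b` on real vectors with integer coefficients. -/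
def intAffineMap {ι : Type*} {n : ℕ} (M : Matrix ι (Fin n) ℤ) (b : ι → ℤ) (x : Fin n → ℝ) :
    ι → ℝ :=
  fun i => (∑ j, (M i j : ℝ) * x j) + (b i : ℝ)

section IntAffine

variable {ι : Type*} {n : ℕ}

theorem isIntAffine_iff {m : ℕ} {g : (Fin n → ℝ) → (Fin m → ℝ)} :
    IsIntAffine g ↔ ∃ (M : Matrix (Fin m) (Fin n) ℤ) (b : Fin m → ℤ), g = intAffineMap M b := by
  constructor
  · rintro ⟨M, b, h⟩
    exact ⟨M, b, funext fun x => funext fun i => h x i⟩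
  · rintro ⟨M, b, rfl⟩
    exact ⟨M, b, fun x i => rfl⟩

theorem continuous_intAffineMap (M : Matrix ι (Fin n) ℤ) (b : ι → ℤ) :
    Continuous (intAffineMap M b) := by
  unfold intAffineMap
  fun_prop

theorem intAffineMap_add_smul (M : Matrix ι (Fin n) ℤ) (b : ι → ℤ) (x d : Fin n → ℝ) (t : ℝ)
    (i : ι) :
    intAffineMap M b (x + t • d) i = intAffineMap M b x i + t * ∑ j, (M i j : ℝ) * d j := by
  simp only [intAffineMap, Pi.add_apply, Pi.smul_apply, smul_eq_mul, mul_add,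
    Finset.sum_add_distrib, Finset.mul_sum]
  have : ∀ j, (M i j : ℝ) * (t * d j) = t * ((M i j : ℝ) * d j) := fun j => by ring
  simp only [this]
  ring

theorem intAffineMap_sub (M : Matrix ι (Fin n) ℤ) (b : ι → ℤ) (x y : Fin n → ℝ) (i : ι) :
    ∑ j, (M i j : ℝ) * (y - x) j = intAffineMap M b y i - intAffineMap M b x i := by
  simp only [intAffineMap, Pi.sub_apply, mul_sub, Finset.sum_sub_distrib]
  ring

theorem intAffineMap_lineMap (M : Matrix ι (Fin n) ℤ) (b : ι → ℤ) {x y : Fin n → ℝ} {s t : ℝ}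
    (hst : s + t = 1) (i : ι) :
    intAffineMap M b (s • x + t • y) i = s * intAffineMap M b x i + t * intAffineMap M b y i := by
  obtain rfl : s = 1 - t := by linarith
  have : (1 - t) • x + t • y = x + t • (y - x) := by module
  rw [this, intAffineMap_add_smul, intAffineMap_sub M b]
  ring

theorem intAffineMap_comp {l m : ℕ} (N : Matrix (Fin l) (Fin m) ℤ) (c : Fin l → ℤ)
    (M : Matrix (Fin m) (Fin n) ℤ) (b : Fin m → ℤ) (x : Fin n → ℝ) :
    intAffineMap N c (intAffineMap M b x) =
      intAffineMap (N * M) (fun i => ∑ j, N i j * b j + c i) x := by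
  funext i
  simp only [intAffineMap, Matrix.mul_apply, mul_add, Finset.sum_add_distrib, Finset.mul_sum]
  push_cast
  simp only [Finset.sum_mul]
  rw [Finset.sum_comm]
  simp only [mul_assoc]
  ring

/-- The set of solutions of finitely many integer affine inequalities `Mx + b ≥ 0`. -/
def intPolyhedron (M : Matrix ι (Fin n) ℤ) (b : ι → ℤ) : Set (Fin n → ℝ) :=
  {x | ∀ i, 0 ≤ intAffineMap M b x i}

theorem isClosed_intPolyhedron (M : Matrix ι (Fin n) ℤ) (b : ι → ℤ) :
    IsClosed (intPolyhedron M b) := by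
  simp only [intPolyhedron, Set.ofPred_forall]
  exact isClosed_iInter fun i =>
    isClosed_le continuous_const ((continuous_apply i).comp (continuous_intAffineMap M b))

theorem convex_intPolyhedron (M : Matrix ι (Fin n) ℤ) (b : ι → ℤ) :
    Convex ℝ (intPolyhedron M b) := by
  intro x hx y hy s t hs ht hst i
  rw [intAffineMap_lineMap M b hst]
  have := hx i
  have := hy i
  positivity

theorem eq_zero_of_mem_extremePoints [Finite ι] {M : Matrix ι (Fin n) ℤ} {b : ι → ℤ}
    {x d : Fin n → ℝ} (hx : x ∈ (intPolyhedron M b).extremePoints ℝ)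
    (hd : ∀ i, intAffineMap M b x i = 0 → ∑ j, (M i j : ℝ) * d j = 0) : d = 0 := by
  have key : ∀ᶠ t : ℝ in nhds 0, x + t • d ∈ intPolyhedron M b := by
    refine Filter.eventually_all.2 fun i => ?_
    simp only [intAffineMap_add_smul]
    rcases (hx.1 i).eq_or_lt with h | h
    · simp [← h, hd i h.symm]
    · have hc : Filter.Tendsto (fun t : ℝ => intAffineMap M b x i + t * ∑ j, (M i j : ℝ) * d j)
          (nhds 0) (nhds (intAffineMap M b x i + 0 * ∑ j, (M i j : ℝ) * d j)) :=
        Continuous.tendsto (by fun_prop) 0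
      rw [zero_mul, add_zero] at hc
      exact (hc.eventually (lt_mem_nhds h)).mono fun t ht => ht.le
  obtain ⟨ε, hε, hball⟩ := Metric.eventually_nhds_iff.1 key
  have h1 : x + (ε / 2) • d ∈ intPolyhedron M b := hball (by
    rw [Real.dist_eq, sub_zero, abs_of_pos (by positivity)]; linarith)
  have h2 : x + (-(ε / 2)) • d ∈ intPolyhedron M b := hball (by
    rw [Real.dist_eq, sub_zero, abs_neg, abs_of_pos (by positivity)]; linarith)
  have h3 := ((mem_extremePoints.1 hx).2 _ h1 _ h2
    ⟨1 / 2, 1 / 2, by norm_num, by norm_num, by norm_num, by module⟩).1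
  rw [add_eq_left, smul_eq_zero] at h3
  exact h3.resolve_left (by positivity)

theorem finite_extremePoints_intPolyhedron [Finite ι] (M : Matrix ι (Fin n) ℤ) (b : ι → ℤ) :
    ((intPolyhedron M b).extremePoints ℝ).Finite := by
  refine Set.Finite.of_injOn (f := fun x => {i | intAffineMap M b x i = 0}) (t := Set.univ)
    (Set.mapsTo_univ _ _) ?_ Set.finite_univ
  intro x hx y hy hxy
  refine (sub_eq_zero.1 (eq_zero_of_mem_extremePoints hx (d := y - x) fun i hi => ?_)).symm
  have hi' : i ∈ {i | intAffineMap M b y i = 0} := by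
    rw [← show {i | intAffineMap M b x i = 0} = {i | intAffineMap M b y i = 0} from hxy]
    exact hi
  rw [intAffineMap_sub M b, hi, hi', sub_zero]

theorem isRationalPoint_of_mem_extremePoints [Fintype ι] {M : Matrix ι (Fin n) ℤ}
    {b : ι → ℤ} {x : Fin n → ℝ} (hx : x ∈ (intPolyhedron M b).extremePoints ℝ) :
    IsRationalPoint x := by
  classical
  obtain ⟨A, hA⟩ : ∃ A : Matrix ι (Fin n) ℚ, ∀ i j,
      A i j = if intAffineMap M b x i = 0 then (M i j : ℚ) else 0 := ⟨_, fun _ _ => rfl⟩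
  have hker : A.toLin'.ker = ⊥ := by
    refine LinearMap.ker_eq_bot'.2 fun v hv => ?_
    have hv0 : (fun j => (v j : ℝ)) = 0 := by
      refine eq_zero_of_mem_extremePoints hx fun i hi => ?_
      have hvi : ∑ j, A i j * v j = 0 := congrFun hv i
      simp only [hA, hi, if_true] at hvi
      exact_mod_cast hvi
    funext j
    have : (v j : ℝ) = 0 := congrFun hv0 j
    exact_mod_cast this
  obtain ⟨g, hg⟩ := A.toLin'.exists_leftInverse_of_injective hker
  have hBA : LinearMap.toMatrix' g * A = 1 := by
    rw [← LinearMap.toMatrix'_toLin' A, ← LinearMap.toMatrix'_comp, hg, LinearMap.toMatrix'_id]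
  set B := LinearMap.toMatrix' g
  intro j
  refine ⟨∑ i, B j i * (if intAffineMap M b x i = 0 then -(b i : ℚ) else 0), ?_⟩
  have h1 : ∀ i, ∑ l, (A i l : ℝ) * x l =
      ((if intAffineMap M b x i = 0 then -(b i : ℚ) else 0 : ℚ) : ℝ) := by
    intro i
    by_cases hi : intAffineMap M b x i = 0
    · simp only [hA, hi, if_true]
      simp only [intAffineMap] at hi
      push_cast
      linarith
    · simp [hA, hi]
  push_cast [← h1]
  have h2 : ∀ l, ∑ i, (B j i : ℝ) * (A i l : ℝ) = if j = l then 1 else 0 := by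
    intro l
    have := congrFun (congrFun hBA j) l
    rw [Matrix.mul_apply, Matrix.one_apply] at this
    have h3 := congrArg ((↑) : ℚ → ℝ) this
    rw [Rat.cast_sum, apply_ite ((↑) : ℚ → ℝ), Rat.cast_one, Rat.cast_zero] at h3
    simpa only [Rat.cast_mul] using h3
  simp only [Finset.mul_sum, ← mul_assoc]
  rw [Finset.sum_comm]
  simp only [← Finset.sum_mul, h2]
  simp

theorem intPolyhedron_eq_convexHull [Fintype ι] {M : Matrix ι (Fin n) ℤ} {b : ι → ℤ}
    (hb : intPolyhedron M b ⊆ cubeSet n) :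
    ∃ F : Finset (Fin n → ℝ), (∀ v ∈ F, IsRationalPoint v) ∧
      intPolyhedron M b = convexHull ℝ (F : Set (Fin n → ℝ)) := by
  have hfin := finite_extremePoints_intPolyhedron M b
  refine ⟨hfin.toFinset, fun v hv => isRationalPoint_of_mem_extremePoints (hfin.mem_toFinset.1 hv),
    ?_⟩
  have hcpt : IsCompact (intPolyhedron M b) :=
    isCompact_Icc.of_isClosed_subset (isClosed_intPolyhedron M b) hb
  rw [hfin.coe_toFinset, ← (hfin.isCompact_convexHull ℝ).isClosed.closure_eq,
    closure_convexHull_extremePoints hcpt (convex_intPolyhedron M b)]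

end IntAffine

section Cells

variable {ι : Type*} {n : ℕ}

/-- The points at which the components of `Mx + b` have prescribed signs. -/
def openCell (M : Matrix ι (Fin n) ℤ) (b : ι → ℤ) (s : ι → SignType) : Set (Fin n → ℝ) :=
  {x | ∀ i, SignType.sign (intAffineMap M b x i) = s i}

/-- The closed polyhedron obtained by weakening the sign conditions of `openCell`. -/
def closedCell (M : Matrix ι (Fin n) ℤ) (b : ι → ℤ) (s : ι → SignType) : Set (Fin n → ℝ) :=
  intPolyhedron (ι := ι × Bool)
    (fun p j => if p.2 then (if s p.1 = -1 then 0 else M p.1 j)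
      else (if s p.1 = 1 then 0 else -M p.1 j))
    (fun p => if p.2 then (if s p.1 = -1 then 0 else b p.1)
      else (if s p.1 = 1 then 0 else -b p.1))

theorem mem_closedCell {M : Matrix ι (Fin n) ℤ} {b : ι → ℤ} {s : ι → SignType} {x : Fin n → ℝ} :
    x ∈ closedCell M b s ↔ ∀ i, (s i ≠ -1 → 0 ≤ intAffineMap M b x i) ∧
      (s i ≠ 1 → intAffineMap M b x i ≤ 0) := by
  simp only [closedCell, intPolyhedron, Set.mem_ofPred_eq, Prod.forall, Bool.forall_bool,
    intAffineMap]
  refine forall_congr' fun i => ?_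
  rw [and_comm]
  refine and_congr ?_ ?_
  · by_cases h : s i = -1 <;> simp [h]
  · by_cases h : s i = 1 <;> simp [h]
    constructor <;> intro h' <;> linarith

theorem openCell_subset_closedCell (M : Matrix ι (Fin n) ℤ) (b : ι → ℤ) (s : ι → SignType) :
    openCell M b s ⊆ closedCell M b s := by
  refine fun x hx => mem_closedCell.2 fun i => ⟨fun h => ?_, fun h => ?_⟩
  · rw [← hx i] at h
    by_contra! hlt
    exact h (sign_neg hlt)
  · rw [← hx i] at h
    by_contra! hlt
    exact h (sign_pos hlt)

theorem lineMap_mem_openCell {M : Matrix ι (Fin n) ℤ} {b : ι → ℤ} {s : ι → SignType}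
    {x z : Fin n → ℝ} (hx : x ∈ closedCell M b s) (hz : z ∈ openCell M b s) {p q : ℝ}
    (hp : 0 ≤ p) (hq : 0 < q) (hpq : p + q = 1) : p • x + q • z ∈ openCell M b s := by
  intro i
  have hzi := hz i
  have hxi := mem_closedCell.1 hx i
  rw [intAffineMap_lineMap M b hpq]
  rw [← hzi] at hxi ⊢
  rcases lt_trichotomy (intAffineMap M b z i) 0 with h | h | h
  · rw [sign_neg h] at hxi ⊢
    have := hxi.2 (by decide)
    exact sign_neg (by nlinarith)
  · rw [h, sign_zero] at hxi
    have : intAffineMap M b x i = 0 := le_antisymm (hxi.2 (by decide)) (hxi.1 (by decide))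
    simp [this, h]
  · rw [sign_pos h] at hxi ⊢
    have := hxi.1 (by decide)
    exact sign_pos (by positivity)

theorem convex_openCell (M : Matrix ι (Fin n) ℤ) (b : ι → ℤ) (s : ι → SignType) :
    Convex ℝ (openCell M b s) := by
  intro x hx y hy p q hp hq hpq
  rcases hq.eq_or_lt with rfl | hq
  · obtain rfl : p = 1 := by linarith
    simpa using hx
  · exact lineMap_mem_openCell (openCell_subset_closedCell M b s hx) hy hp hq hpq

theorem closedCell_subset_closure {M : Matrix ι (Fin n) ℤ} {b : ι → ℤ} {s : ι → SignType}
    (hne : (openCell M b s).Nonempty) : closedCell M b s ⊆ closure (openCell M b s) := by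
  obtain ⟨z, hz⟩ := hne
  intro x hx
  have hlim : Filter.Tendsto (fun t : ℝ => (1 - t) • x + t • z) (nhdsWithin 0 (Set.Ioo 0 1))
      (nhds x) := by
    have : Filter.Tendsto (fun t : ℝ => (1 - t) • x + t • z) (nhds 0)
        (nhds ((1 - (0 : ℝ)) • x + (0 : ℝ) • z)) := Continuous.tendsto (by fun_prop) 0
    simp only [sub_zero, one_smul, zero_smul, add_zero] at this
    exact this.mono_left nhdsWithin_le_nhds
  have : (nhdsWithin (0 : ℝ) (Set.Ioo 0 1)).NeBot := by
    rw [nhdsWithin_Ioo_eq_nhdsGT one_pos]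
    infer_instance
  exact mem_closure_of_tendsto hlim (eventually_nhdsWithin_of_forall fun t ht =>
    lineMap_mem_openCell hx hz (by linarith [ht.2]) ht.1 (by ring))

theorem isRationalPolyhedron_of_openCell [Fintype ι] (M : Matrix ι (Fin n) ℤ) (b : ι → ℤ)
    {P : Set (Fin n → ℝ)} (hP : IsClosed P) (hcube : P ⊆ cubeSet n)
    (hcell : ∀ x ∈ P, openCell M b (fun i => SignType.sign (intAffineMap M b x i)) ⊆ P) :
    IsRationalPolyhedron P := by
  classical
  let σ : (Fin n → ℝ) → ι → SignType := fun x i => SignType.sign (intAffineMap M b x i)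
  have hsub : ∀ s ∈ σ '' P, closedCell M b s ⊆ P := by
    rintro _ ⟨x, hx, rfl⟩
    exact (closedCell_subset_closure ⟨x, fun i => rfl⟩).trans
      (closure_minimal (hcell x hx) hP)
  have hF : ∀ s : ι → SignType, ∃ F : Finset (Fin n → ℝ), s ∈ σ '' P →
      (∀ v ∈ F, IsRationalPoint v) ∧ closedCell M b s = convexHull ℝ (F : Set (Fin n → ℝ)) := by
    intro s
    by_cases hs : s ∈ σ '' P
    · obtain ⟨F, hF⟩ := intPolyhedron_eq_convexHull ((hsub s hs).trans hcube)
      exact ⟨F, fun _ => hF⟩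
    · exact ⟨∅, fun h => absurd h hs⟩
  choose F hF using hF
  refine ⟨(Set.toFinite (σ '' P)).toFinset.image F, ?_, ?_⟩
  · intro G hG
    obtain ⟨s, hs, rfl⟩ := Finset.mem_image.1 hG
    exact (hF s ((Set.Finite.mem_toFinset _).1 hs)).1
  · ext x
    simp only [Set.mem_iUnion, Finset.mem_image, Set.Finite.mem_toFinset, exists_prop]
    constructor
    · intro hx
      have hs : σ x ∈ σ '' P := ⟨x, hx, rfl⟩
      refine ⟨_, ⟨σ x, hs, rfl⟩, ?_⟩
      rw [← (hF _ hs).2]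
      exact openCell_subset_closedCell M b _ fun i => rfl
    · rintro ⟨_, ⟨s, hs, rfl⟩, hx⟩
      rw [← (hF s hs).2] at hx
      exact hsub s hs hx

end Cells

section Retractions

variable {n : ℕ}

theorem IsZRetraction.zRange_eq {ρ : (Fin n → ℝ) → (Fin n → ℝ)} (hρ : IsZRetraction ρ) :
    zRange ρ = {x ∈ cubeSet n | ρ x = x} := by
  ext x
  constructor
  · rintro ⟨y, hy, rfl⟩
    exact ⟨hρ.2.1 hy, hρ.2.2 y hy⟩
  · rintro ⟨hx, h⟩
    exact ⟨x, hx, h⟩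

theorem IsZRetraction.apply_eq {ρ : (Fin n → ℝ) → (Fin n → ℝ)} (hρ : IsZRetraction ρ)
    {x : Fin n → ℝ} (hx : x ∈ zRange ρ) : ρ x = x := by
  rw [hρ.zRange_eq] at hx
  exact hx.2

theorem IsZRetraction.zRange_subset {ρ : (Fin n → ℝ) → (Fin n → ℝ)} (hρ : IsZRetraction ρ) :
    zRange ρ ⊆ cubeSet n := by
  rw [hρ.zRange_eq]
  exact Set.sep_subset _ _

theorem IsZRetraction.isClosed_zRange {ρ : (Fin n → ℝ) → (Fin n → ℝ)} (hρ : IsZRetraction ρ) :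
    IsClosed (zRange ρ) := by
  have : IsCompact (zRange ρ) := IsCompact.image_of_continuousOn isCompact_Icc hρ.1.1
  exact this.isClosed

theorem IsZMapOn.exists_pieces {m : ℕ} {P : Set (Fin n → ℝ)} {f : (Fin n → ℝ) → (Fin m → ℝ)}
    (hf : IsZMapOn P f) : ∃ (k : ℕ) (M : Fin k → Matrix (Fin m) (Fin n) ℤ)
      (b : Fin k → Fin m → ℤ), ∀ x ∈ P, ∃ i, f x = intAffineMap (M i) (b i) x := by
  obtain ⟨-, k, g, hg, hfg⟩ := hf
  choose M b hMb using fun i => isIntAffine_iff.1 (hg i)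
  exact ⟨k, M, b, by simpa only [hMb] using hfg⟩

theorem isRationalPolyhedron_zRange {ρ : (Fin n → ℝ) → (Fin n → ℝ)} (hρ : IsZRetraction ρ) :
    IsRationalPolyhedron (zRange ρ) := by
  obtain ⟨k, M, b, hMb⟩ := hρ.1.exists_pieces
  let A : Matrix ((Fin k × Fin n) ⊕ (Fin n ⊕ Fin n)) (Fin n) ℤ := fun r j =>
    r.elim (fun p => M p.1 p.2 j - (1 : Matrix (Fin n) (Fin n) ℤ) p.2 j)
      (fun r => r.elim (fun l => (1 : Matrix (Fin n) (Fin n) ℤ) l j)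
        (fun l => (1 : Matrix (Fin n) (Fin n) ℤ) l j))
  let c : (Fin k × Fin n) ⊕ (Fin n ⊕ Fin n) → ℤ := fun r =>
    r.elim (fun p => b p.1 p.2) (fun r => r.elim (fun _ => 0) (fun _ => -1))
  have hone : ∀ (x : Fin n → ℝ) l,
      ∑ j, (((1 : Matrix (Fin n) (Fin n) ℤ) l j : ℤ) : ℝ) * x j = x l := by
    intro x l
    simp [Matrix.one_apply]
  have hpiece : ∀ x i l, intAffineMap A c x (Sum.inl (i, l)) =
      intAffineMap (M i) (b i) x l - x l := by
    intro x i l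
    simp only [intAffineMap, A, c, Sum.elim_inl, Int.cast_sub, sub_mul, Finset.sum_sub_distrib,
      hone]
    ring
  have hlow : ∀ x l, intAffineMap A c x (Sum.inr (Sum.inl l)) = x l := by
    intro x l
    simp only [intAffineMap, A, c, Sum.elim_inl, Sum.elim_inr, hone]
    simp
  have hhigh : ∀ x l, intAffineMap A c x (Sum.inr (Sum.inr l)) = x l - 1 := by
    intro x l
    simp only [intAffineMap, A, c, Sum.elim_inr, hone]
    simp [sub_eq_add_neg]
  refine isRationalPolyhedron_of_openCell A c hρ.isClosed_zRange hρ.zRange_subset ?_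
  intro x hx
  set s : _ → SignType := fun r => SignType.sign (intAffineMap A c x r) with hs
  have hxs : x ∈ openCell A c s := fun i => rfl
  have hxc := hρ.zRange_subset hx
  have hcube : openCell A c s ⊆ cubeSet n := by
    intro y hy
    have hy' := mem_closedCell.1 (openCell_subset_closedCell A c s hy)
    refine ⟨fun l => ?_, fun l => ?_⟩
    · have h := (hy' (Sum.inr (Sum.inl l))).1
      rw [hlow] at h
      refine h fun h' => ?_
      simp only [hs, hlow, sign_eq_neg_one_iff] at h'
      exact absurd (hxc.1 l) (not_le.2 h')
    · have h := (hy' (Sum.inr (Sum.inr l))).2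
      rw [hhigh] at h
      refine sub_nonpos.1 (h fun h' => ?_)
      simp only [hs, hhigh, sign_eq_one_iff, sub_pos] at h'
      exact absurd (hxc.2 l) (not_le.2 h')
  have hfix : ∀ i, ∀ y ∈ openCell A c s, ∀ z ∈ openCell A c s,
      intAffineMap (M i) (b i) y = y → intAffineMap (M i) (b i) z = z := by
    intro i y hy z hz h
    funext l
    have h1 := (hy (Sum.inl (i, l))).trans (hz (Sum.inl (i, l))).symm
    rw [hpiece, hpiece, h, sub_self, sign_zero, eq_comm, sign_eq_zero_iff, sub_eq_zero] at h1
    exact h1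
  have hcont : ContinuousOn ρ (openCell A c s) := hρ.1.1.mono hcube
  intro y hy
  by_contra hyP
  -- the pieces that agree with the identity on the cell, and the remaining ones
  let I : Set (Fin k) := {i | intAffineMap (M i) (b i) x = x}
  let T : Set (Fin k) → Set (openCell A c s) := fun J =>
    ⋃ i ∈ J, {z | ρ z = intAffineMap (M i) (b i) z}
  have hT : ∀ J, IsClosed (T J) := fun J => (Set.toFinite J).isClosed_biUnion fun i _ =>
    isClosed_eq hcont.domRestrict ((continuous_intAffineMap _ _).comp continuous_subtype_val)
  have : PreconnectedSpace (openCell A c s) :=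
    Subtype.preconnectedSpace (convex_openCell A c s).isPreconnected
  have hmem : ∀ z : openCell A c s, ∃ i, ρ z = intAffineMap (M i) (b i) z :=
    fun z => hMb z (hcube z.2)
  obtain ⟨z, -, hz1, hz2⟩ := isPreconnected_closed_iff.1
    (isPreconnected_univ (α := openCell A c s)) (T I) (T Iᶜ) (hT _) (hT _)
    (fun z _ => by
      obtain ⟨i, hi⟩ := hmem z
      by_cases h : i ∈ I
      · exact Or.inl (Set.mem_biUnion h hi)
      · exact Or.inr (Set.mem_biUnion h hi))
    (by
      obtain ⟨i, hi⟩ := hmem ⟨x, hxs⟩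
      exact ⟨⟨x, hxs⟩, Set.mem_univ _,
        Set.mem_biUnion (show i ∈ I from hi.symm.trans (hρ.apply_eq hx)) hi⟩)
    (by
      obtain ⟨i, hi⟩ := hmem ⟨y, hy⟩
      refine ⟨⟨y, hy⟩, Set.mem_univ _, Set.mem_biUnion (fun h => hyP ?_) hi⟩
      rw [hρ.zRange_eq]
      exact ⟨hcube hy, hi.trans (hfix i x hxs y hy h)⟩)
  simp only [T, Set.mem_iUnion, Set.mem_ofPred_eq, exists_prop] at hz1 hz2
  obtain ⟨i, hiI, hi⟩ := hz1
  obtain ⟨j, hjI, hj⟩ := hz2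
  exact hjI (hfix j z z.2 x hxs (hj.symm.trans (hi.trans (hfix i x hxs z z.2 hiI))))

theorem eq_one_of_forall_intAffineMap_eq {L : Matrix (Fin n) (Fin n) ℤ} {e : Fin n → ℤ}
    (h : ∀ y : Fin n → ℝ, intAffineMap L e y = y) : L = 1 := by
  have he : ∀ i, (e i : ℝ) = 0 := fun i => by
    simpa [intAffineMap] using congrFun (h 0) i
  ext i j
  have := congrFun (h (Pi.single j 1)) i
  simp only [intAffineMap, he, Pi.single_apply, mul_ite, mul_one, mul_zero, Finset.sum_ite_eq',
    Finset.mem_univ, if_true, add_zero] at this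
  rw [Matrix.one_apply]
  exact_mod_cast this

theorem volume_fixedPoints_intAffineMap {L : Matrix (Fin n) (Fin n) ℤ} (hL : L ≠ 1)
    (e : Fin n → ℤ) : volume {y : Fin n → ℝ | intAffineMap L e y = y} = 0 := by
  let S : AffineSubspace ℝ (Fin n → ℝ) :=
    { carrier := {y | intAffineMap L e y = y}
      smul_vsub_vadd_mem' := by
        intro t p q r hp hq hr
        funext i
        rw [vsub_eq_sub, vadd_eq_add, add_comm, intAffineMap_add_smul, intAffineMap_sub L e,
          show intAffineMap L e p = p from hp, show intAffineMap L e q = q from hq,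
          show intAffineMap L e r = r from hr]
        rfl }
  refine Measure.addHaar_affineSubspace volume S fun hS => hL ?_
  refine eq_one_of_forall_intAffineMap_eq (e := e) fun y => ?_
  have : y ∈ S := hS ▸ AffineSubspace.mem_top ℝ _ y
  exact this

theorem eq_zRange_of_isZHomeoDomain {σ : (Fin n → ℝ) → (Fin n → ℝ)} (hσ : IsZRetraction σ)
    (hcd : IsClosedDomain (zRange σ)) {κ : Type*} [Countable κ]
    {N : κ → Matrix (Fin n) (Fin n) ℤ} {c : κ → Fin n → ℤ} (hN : ∀ j, ¬IsUnit (N j).det)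
    (hσN : ∀ x ∈ cubeSet n, x ∉ zRange σ → ∃ j, σ x = intAffineMap (N j) (c j) x)
    {Q : Set (Fin n → ℝ)} (hQ : IsZHomeoDomain σ Q) : Q = zRange σ := by
  obtain ⟨-, hQc, -, himg, -, g, hg, hgσ, hσg⟩ := hQ
  have hgQ : ∀ y ∈ zRange σ, g y ∈ Q := by
    intro y hy
    obtain ⟨x, hx, rfl⟩ := himg.symm ▸ hy
    rwa [hgσ x hx]
  have hint : Set.MapsTo g (interior (zRange σ)) (zRange σ) := by
    intro y₀ hy₀
    by_contra hgy
    have hcont : ContinuousOn g (interior (zRange σ)) := hg.1.mono interior_subset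
    have hopen := hcont.isOpen_inter_preimage isOpen_interior hσ.isClosed_zRange.isOpen_compl
    set U := interior (zRange σ) ∩ g ⁻¹' (zRange σ)ᶜ
    refine (hopen.measure_pos volume ⟨y₀, hy₀, hgy⟩).ne' ?_
    obtain ⟨k, M, b, hMb⟩ := hg.exists_pieces
    refine measure_mono_null (t := ⋃ p : κ × Fin k,
      {y | intAffineMap (N p.1) (c p.1) (intAffineMap (M p.2) (b p.2) y) = y}) ?_ ?_
    · intro y hy
      have hyP := interior_subset hy.1
      obtain ⟨i, hi⟩ := hMb y hyP
      obtain ⟨j, hj⟩ := hσN (g y) (hQc (hgQ y hyP)) hy.2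
      refine Set.mem_iUnion.2 ⟨(j, i), ?_⟩
      simp only [Set.mem_ofPred_eq]
      rw [← hi, ← hj, hσg y hyP]
    · refine measure_iUnion_null fun p => ?_
      simp only [intAffineMap_comp]
      refine volume_fixedPoints_intAffineMap (fun h => hN p.1 ?_) _
      exact IsUnit.of_mul_eq_one _ (by rw [← Matrix.det_mul, h, Matrix.det_one])
  have hall : Set.MapsTo g (zRange σ) (zRange σ) := by
    have := hint.closure_of_continuousOn (by rw [hcd]; exact hg.1)
    rwa [hcd, hσ.isClosed_zRange.closure_eq] at this
  have hid : ∀ y ∈ zRange σ, g y = y := fun y hy => by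
    rw [← hσ.apply_eq (hall hy), hσg y hy]
  ext x
  constructor
  · intro hx
    have hσx : σ x ∈ zRange σ := ⟨x, hQc hx, rfl⟩
    rw [← hgσ x hx]
    exact hall hσx
  · intro hx
    rw [← hid x hx]
    exact hgQ x hx

theorem isIntAffine_id : IsIntAffine (id : (Fin n → ℝ) → (Fin n → ℝ)) :=
  ⟨fun i j => (1 : Matrix (Fin n) (Fin n) ℤ) i j, 0, fun x i => by simp [Matrix.one_apply]⟩

theorem isZMapOn_id (P : Set (Fin n → ℝ)) : IsZMapOn P (id : (Fin n → ℝ) → (Fin n → ℝ)) :=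
  ⟨continuousOn_id, 1, fun _ => id, fun _ => isIntAffine_id, fun _ _ => ⟨0, rfl⟩⟩

theorem isZHomeoDomain_zRange {σ : (Fin n → ℝ) → (Fin n → ℝ)} (hσ : IsZRetraction σ) :
    IsZHomeoDomain σ (zRange σ) := by
  have hid := fun x (hx : x ∈ zRange σ) => hσ.apply_eq hx
  obtain ⟨hc, k, g, hg, hσg⟩ := hσ.1
  refine ⟨isRationalPolyhedron_zRange hσ, hσ.zRange_subset,
    ⟨hc.mono hσ.zRange_subset, k, g, hg, fun x hx => hσg x (hσ.zRange_subset hx)⟩, ?_, ?_,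
    id, isZMapOn_id _, hid, hid⟩
  · rw [Set.image_congr hid, Set.image_id']
  · intro x hx y hy hxy
    rwa [hid x hx, hid y hy] at hxy

theorem exists_isMVIsoFun_retAlg {ρ σ : (Fin n → ℝ) → (Fin n → ℝ)} (hρ : IsZRetraction ρ)
    (hσ : IsZRetraction σ) (h : zRange σ = zRange ρ) :
    ∃ φ : ↥(retAlg σ) → ↥(retAlg ρ), IsMVIsoFun (retAlg σ) (retAlg ρ) φ := by
  have hρσ : ∀ x ∈ cubeSet n, ρ (σ x) = σ x := fun x hx => hρ.apply_eq (h ▸ ⟨x, hx, rfl⟩)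
  have hσρ : ∀ x ∈ cubeSet n, σ (ρ x) = ρ x := fun x hx => hσ.apply_eq (h ▸ ⟨x, hx, rfl⟩)
  let r : cubeSet n → cubeSet n := fun x => ⟨ρ x, hρ.2.1 x.2⟩
  have hmem : ∀ f ∈ retAlg σ, f ∘ r ∈ retAlg ρ := by
    rintro f ⟨g, hg, hfg⟩
    refine ⟨g, hg, fun x hx => ?_⟩
    have hσr : σ (r x) = ρ x := hσρ x x.2
    rw [Function.comp_apply, hfg (r x) (hσr ▸ hx)]
    simp only [hσr]
  refine ⟨fun f => ⟨f.1 ∘ r, hmem f.1 f.2⟩, ⟨?_, ?_⟩, fun f g hm => rfl, fun f hm => rfl⟩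
  · rintro ⟨f₁, g₁, hg₁, h₁⟩ ⟨f₂, g₂, hg₂, h₂⟩ heq
    have heq' : f₁ ∘ r = f₂ ∘ r := congrArg Subtype.val heq
    refine Subtype.ext (funext fun x => ?_)
    dsimp only
    have hx := congrFun heq' ⟨σ x, hσ.2.1 x.2⟩
    have hr : σ (ρ (σ x)) = σ x := by rw [hρσ x x.2, hσ.2.2 x x.2]
    rw [Function.comp_apply, Function.comp_apply, h₁ _ (hσ.2.1 (r _).2),
      h₂ _ (hσ.2.1 (r _).2)] at hx
    simp only [r, hr] at hx
    rw [h₁ x (hσ.2.1 x.2), h₂ x (hσ.2.1 x.2)]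
    exact hx
  · rintro ⟨f, g, hg, hf⟩
    refine ⟨⟨fun x => g ⟨σ x, hσ.2.1 x.2⟩, g, hg, fun x _ => rfl⟩,
      Subtype.ext (funext fun x => ?_)⟩
    dsimp only
    rw [hf x (hρ.2.1 x.2)]
    simp only [Function.comp_apply, r, hσρ x x.2]

theorem isZMapOn_of_pieces {m : ℕ} {P : Set (Fin n → ℝ)} {f : (Fin n → ℝ) → (Fin m → ℝ)}
    (hf : ContinuousOn f P) {κ : Type*} [Finite κ] {N : κ → Matrix (Fin m) (Fin n) ℤ}
    {e : κ → Fin m → ℤ} (h : ∀ x ∈ P, ∃ p, f x = intAffineMap (N p) (e p) x) :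
    IsZMapOn P f := by
  obtain ⟨k, ⟨eqv⟩⟩ := Finite.exists_equiv_fin κ
  refine ⟨hf, k, fun i => intAffineMap (N (eqv.symm i)) (e (eqv.symm i)),
    fun i => isIntAffine_iff.2 ⟨_, _, rfl⟩, fun x hx => ?_⟩
  obtain ⟨p, hp⟩ := h x hx
  exact ⟨eqv p, by simpa only [eqv.symm_apply_apply] using hp⟩

theorem IsZMapOn.comp {l m : ℕ} {P : Set (Fin n → ℝ)} {Q : Set (Fin m → ℝ)}
    {f : (Fin m → ℝ) → (Fin l → ℝ)} {g : (Fin n → ℝ) → (Fin m → ℝ)} (hf : IsZMapOn Q f)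
    (hg : IsZMapOn P g) (hgPQ : Set.MapsTo g P Q) : IsZMapOn P (f ∘ g) := by
  obtain ⟨k, M, b, hMb⟩ := hf.exists_pieces
  obtain ⟨k', M', b', hMb'⟩ := hg.exists_pieces
  refine isZMapOn_of_pieces (hf.1.comp hg.1 hgPQ) (κ := Fin k × Fin k')
    (N := fun p => M p.1 * M' p.2)
    (e := fun p i => ∑ j, M p.1 i j * b' p.2 j + b p.1 i) fun x hx => ?_
  obtain ⟨j, hj⟩ := hMb' x hx
  obtain ⟨i, hi⟩ := hMb (g x) (hgPQ hx)
  refine ⟨(i, j), ?_⟩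
  rw [Function.comp_apply, hi, hj, intAffineMap_comp]

theorem eq_zero_of_sum_pow_mul_eq_zero {K : ℤ} :
    ∀ {n : ℕ} {a : Fin n → ℤ}, (∀ i, |a i| < K) → ∑ i : Fin n, K ^ (i : ℕ) * a i = 0 → a = 0
  | 0, a, _, _ => Subsingleton.elim _ _
  | n + 1, a, ha, h => by
    rw [Fin.sum_univ_succ] at h
    simp only [Fin.val_zero, pow_zero, one_mul, Fin.val_succ, pow_succ', mul_assoc,
      ← Finset.mul_sum] at h
    have hdvd : K ∣ a 0 := ⟨-∑ i : Fin n, K ^ (i : ℕ) * a i.succ, by linarith⟩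
    have h0 : a 0 = 0 := Int.eq_zero_of_abs_lt_dvd hdvd (ha 0)
    have hK : K ≠ 0 := ((abs_nonneg _).trans_lt (ha 0)).ne'
    have hs : (fun i : Fin n => a i.succ) = 0 := by
      refine eq_zero_of_sum_pow_mul_eq_zero (fun i => ha i.succ) ?_
      rw [h0, zero_add] at h
      exact (mul_eq_zero.1 h).resolve_left hK
    funext i
    refine Fin.cases h0 (fun j => congrFun hs j) i

theorem det_one_sub_vecMulVec {R : Type*} [CommRing R] (u v : Fin n → R) :
    (1 - Matrix.vecMulVec u v).det = 1 - ∑ i, u i * v i := by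
  have h := Matrix.det_one_add_replicateCol_mul_replicateRow (ι := Unit) (-u) v
  rw [← Matrix.vecMulVec_eq, Matrix.neg_vecMulVec, ← sub_eq_add_neg] at h
  rw [h, dotProduct_neg, ← sub_eq_add_neg, dotProduct]
  simp only [mul_comm]

/-- A matrix obtained by replacing some rows of `1 - u vᵀ` by zero, where `u = (K, K², …)`, is
not invertible over `ℤ` as soon as `K` is large and `v` or the set of replaced rows is nonzero. -/
theorem not_isUnit_det_of_rows {K : ℤ} (hK : 3 ≤ K) {v : Fin n → ℤ} (hv : ∀ i, |v i| < K)
    {z : Fin n → Bool} (hz : v ≠ 0 ∨ ∃ i, z i = true) {N : Matrix (Fin n) (Fin n) ℤ}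
    (hN : ∀ i l, N i l =
      if z i then 0 else (1 : Matrix (Fin n) (Fin n) ℤ) i l - K ^ ((i : ℕ) + 1) * v l) :
    ¬IsUnit N.det := by
  by_cases h : ∃ i, z i = true
  · obtain ⟨i, hi⟩ := h
    rw [Matrix.det_eq_zero_of_row_eq_zero i fun l => by simp [hN, hi]]
    exact not_isUnit_zero
  · have hv0 := hz.resolve_right h
    push Not at h
    have hN' : N = 1 - Matrix.vecMulVec (fun i : Fin n => K ^ ((i : ℕ) + 1)) v := by
      ext i l
      rw [hN, if_neg (h i), Matrix.sub_apply, Matrix.vecMulVec_apply]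
    rw [hN', det_one_sub_vecMulVec]
    simp only [pow_succ', mul_assoc, ← Finset.mul_sum]
    have hS : ∑ i : Fin n, K ^ (i : ℕ) * v i ≠ 0 :=
      fun hS => hv0 (eq_zero_of_sum_pow_mul_eq_zero hv hS)
    generalize ∑ i : Fin n, K ^ (i : ℕ) * v i = S at hS
    rw [Int.isUnit_iff]
    rintro (h1 | h1)
    · have : K * S = 0 := by linarith
      rcases mul_eq_zero.1 this with h2 | h2
      · omega
      · exact hS h2
    · have : K ∣ 2 := ⟨S, by linarith⟩
      exact absurd (Int.le_of_dvd (by norm_num) this) (by omega)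

/-- The total displacement of `x` under `ρ`. -/
noncomputable def displacement (ρ : (Fin n → ℝ) → (Fin n → ℝ)) (x : Fin n → ℝ) : ℝ :=
  ∑ l, |ρ x l - x l|

theorem displacement_nonneg (ρ : (Fin n → ℝ) → (Fin n → ℝ)) (x : Fin n → ℝ) :
    0 ≤ displacement ρ x :=
  Finset.sum_nonneg fun _ _ => abs_nonneg _

theorem displacement_eq_zero_iff {ρ : (Fin n → ℝ) → (Fin n → ℝ)} {x : Fin n → ℝ} :
    displacement ρ x = 0 ↔ ρ x = x := by
  rw [displacement, Finset.sum_eq_zero_iff_of_nonneg fun _ _ => abs_nonneg _]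
  simp only [Finset.mem_univ, true_imp_iff, abs_eq_zero, sub_eq_zero, funext_iff]

/-- Push the coordinates of `x` towards `0`, at widely different speeds, by multiples of the
displacement of `x` under `ρ`. -/
noncomputable def pushDown (ρ : (Fin n → ℝ) → (Fin n → ℝ)) (K : ℤ) (x : Fin n → ℝ) : Fin n → ℝ :=
  fun i => max 0 (x i - (K : ℝ) ^ ((i : ℕ) + 1) * displacement ρ x)

theorem pushDown_mapsTo (ρ : (Fin n → ℝ) → (Fin n → ℝ)) {K : ℤ} (hK : 0 ≤ K) :
    Set.MapsTo (pushDown ρ K) (cubeSet n) (cubeSet n) := by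
  refine fun x hx => ⟨fun i => le_max_left _ _, fun i => max_le zero_le_one ?_⟩
  have h1 : x i ≤ 1 := hx.2 i
  have h2 : 0 ≤ (K : ℝ) ^ ((i : ℕ) + 1) * displacement ρ x :=
    mul_nonneg (pow_nonneg (by exact_mod_cast hK) _) (displacement_nonneg ρ x)
  simp only [Pi.one_apply]
  linarith

theorem pushDown_eq_self {ρ : (Fin n → ℝ) → (Fin n → ℝ)} {K : ℤ} {x : Fin n → ℝ}
    (hx : x ∈ cubeSet n) (hρx : ρ x = x) : pushDown ρ K x = x := by
  funext i
  rw [pushDown, displacement_eq_zero_iff.2 hρx, mul_zero, sub_zero]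
  exact max_eq_right (hx.1 i)

theorem continuousOn_pushDown {ρ : (Fin n → ℝ) → (Fin n → ℝ)} (K : ℤ)
    (hρ : ContinuousOn ρ (cubeSet n)) : ContinuousOn (pushDown ρ K) (cubeSet n) := by
  unfold pushDown displacement
  fun_prop

theorem exists_pushDown_pieces (hn : 1 ≤ n) {ρ : (Fin n → ℝ) → (Fin n → ℝ)}
    (hρ : IsZRetraction ρ) :
    ∃ (K : ℤ) (κ : Type) (_ : Finite κ) (N : κ → Matrix (Fin n) (Fin n) ℤ) (e : κ → Fin n → ℤ),
      0 ≤ K ∧ (∀ p, ¬IsUnit (N p).det) ∧ ∀ x ∈ cubeSet n, x ∉ zRange ρ →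
        ∃ p, pushDown ρ K x = intAffineMap (N p) (e p) x := by
  obtain ⟨k, M, b, hMb⟩ := hρ.1.exists_pieces
  let v : Fin k × (Fin n → SignType) → Fin n → ℤ := fun q l =>
    ∑ i, (q.2 i : ℤ) * (M q.1 i l - (1 : Matrix (Fin n) (Fin n) ℤ) i l)
  let c : Fin k × (Fin n → SignType) → ℤ := fun q => ∑ i, (q.2 i : ℤ) * b q.1 i
  obtain ⟨K, hK3, hK⟩ : ∃ K : ℤ, 3 ≤ K ∧ ∀ q l, |v q l| < K := by
    refine ⟨3 + ∑ q, ∑ l, |v q l|, ?_, fun q l => ?_⟩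
    · have : 0 ≤ ∑ q, ∑ l, |v q l| :=
        Finset.sum_nonneg fun _ _ => Finset.sum_nonneg fun _ _ => abs_nonneg _
      linarith
    · have h1 : |v q l| ≤ ∑ l, |v q l| :=
        Finset.single_le_sum (f := fun l => |v q l|) (fun _ _ => abs_nonneg _) (Finset.mem_univ l)
      have h2 : ∑ l, |v q l| ≤ ∑ q, ∑ l, |v q l| :=
        Finset.single_le_sum (f := fun q => ∑ l, |v q l|)
          (fun _ _ => Finset.sum_nonneg fun _ _ => abs_nonneg _) (Finset.mem_univ q)
      linarith
  let N : (Fin k × (Fin n → SignType)) × (Fin n → Bool) → Matrix (Fin n) (Fin n) ℤ :=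
    fun p i l => if p.2 i then 0
      else (1 : Matrix (Fin n) (Fin n) ℤ) i l - K ^ ((i : ℕ) + 1) * v p.1 l
  let e : (Fin k × (Fin n → SignType)) × (Fin n → Bool) → Fin n → ℤ :=
    fun p i => if p.2 i then 0 else -(K ^ ((i : ℕ) + 1) * c p.1)
  refine ⟨K, {p // ¬IsUnit (N p).det}, inferInstance, fun p => N p, fun p => e p, by omega,
    fun p => p.2, fun x hx hxP => ?_⟩
  have hKr : (3 : ℝ) ≤ K := by exact_mod_cast hK3
  obtain ⟨j, hj⟩ := hMb x hx
  let q : Fin k × (Fin n → SignType) := (j, fun i => SignType.sign (ρ x i - x i))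
  have hdisp : displacement ρ x = ∑ l, (v q l : ℝ) * x l + c q := by
    have hi : ∀ i, |ρ x i - x i| = ∑ l, ((q.2 i : ℤ) : ℝ) *
        ((M j i l - (1 : Matrix (Fin n) (Fin n) ℤ) i l : ℤ) : ℝ) * x l +
        ((q.2 i : ℤ) : ℝ) * (b j i : ℝ) := by
      intro i
      have hs : ((q.2 i : ℤ) : ℝ) = (SignType.sign (ρ x i - x i) : ℝ) := by
        simp only [q]
        cases SignType.sign (ρ x i - x i) <;> simp
      have hsum : ∑ l, ((1 : Matrix (Fin n) (Fin n) ℤ) i l : ℝ) * x l = x i := by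
        simp [Matrix.one_apply]
      rw [← sign_mul_self, ← hs, hj]
      simp only [intAffineMap, mul_assoc, ← Finset.mul_sum, Int.cast_sub, sub_mul,
        Finset.sum_sub_distrib, hsum]
      ring
    simp only [displacement, hi, Finset.sum_add_distrib, v, c, Int.cast_sum, Int.cast_mul,
      Finset.sum_mul]
    rw [Finset.sum_comm]
  let z : Fin n → Bool := fun i =>
    decide (x i - (K : ℝ) ^ ((i : ℕ) + 1) * displacement ρ x ≤ 0)
  have hgood : ¬IsUnit (N (q, z)).det := by
    refine not_isUnit_det_of_rows hK3 (hK q) (z := z) ?_ fun i l => rfl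
    by_cases hv : v q = 0
    · right
      simp only [hv, Pi.zero_apply, Int.cast_zero, zero_mul, Finset.sum_const_zero,
        zero_add] at hdisp
      have hpos : 0 < displacement ρ x := (displacement_nonneg ρ x).lt_of_ne' fun h0 =>
        hxP (hρ.zRange_eq ▸ ⟨hx, displacement_eq_zero_iff.1 h0⟩)
      have hone : 1 ≤ displacement ρ x := by
        rw [hdisp] at hpos ⊢
        exact_mod_cast hpos
      have hx1 : x ⟨0, hn⟩ ≤ 1 := hx.2 _
      refine ⟨⟨0, hn⟩, decide_eq_true ?_⟩
      simp only [zero_add, pow_one]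
      nlinarith
    · exact Or.inl hv
  refine ⟨⟨(q, z), hgood⟩, ?_⟩
  funext i
  by_cases hzi : x i - (K : ℝ) ^ ((i : ℕ) + 1) * displacement ρ x ≤ 0
  · have hz : z i = true := decide_eq_true hzi
    rw [pushDown, max_eq_left hzi]
    simp [intAffineMap, N, e, hz]
  · have hz : z i = false := decide_eq_false hzi
    have hsum : ∑ l, ((1 : Matrix (Fin n) (Fin n) ℤ) i l : ℝ) * x l = x i := by
      simp [Matrix.one_apply]
    rw [pushDown, max_eq_right (not_le.1 hzi).le, hdisp]
    simp only [intAffineMap, N, e, hz, Bool.false_eq_true, if_false, Int.cast_sub, Int.cast_mul,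
      Int.cast_neg, Int.cast_pow, sub_mul, Finset.sum_sub_distrib, hsum, mul_assoc,
      ← Finset.mul_sum]
    ring

end Retractions

/-- If `ρ` is a Z-retraction of the cube whose range `P` is a closed domain,
then there is a Z-retraction `ρ'` with the same range `P` whose unique Z-homeomorphism
domain is `P` itself; the associated retract `A_{ρ'}` (isomorphic to `A_ρ`) has
multiplicity 1. -/
theorem stmt16 {n : ℕ} (hn : 1 ≤ n) (ρ : (Fin n → ℝ) → (Fin n → ℝ))
    (hρ : IsZRetraction ρ) (hcd : IsClosedDomain (zRange ρ)) :
    ∃ ρ' : (Fin n → ℝ) → (Fin n → ℝ), IsZRetraction ρ' ∧ zRange ρ' = zRange ρ ∧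
      {Q : Set (Fin n → ℝ) | IsZHomeoDomain ρ' Q} = {zRange ρ} ∧
      ∃ h : ↥(retAlg ρ') → ↥(retAlg ρ), IsMVIsoFun (retAlg ρ') (retAlg ρ) h := by
  obtain ⟨K, κ, _, N, e, hK, hN, hτ⟩ := exists_pushDown_pieces hn hρ
  obtain ⟨k, M, b, hMb⟩ := hρ.1.exists_pieces
  set τ := pushDown ρ K
  have hτc : Set.MapsTo τ (cubeSet n) (cubeSet n) := pushDown_mapsTo ρ hK
  have hτid : ∀ x ∈ zRange ρ, τ x = x := fun x hx =>
    pushDown_eq_self (hρ.zRange_subset hx) (hρ.apply_eq hx)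
  have hτZ : IsZMapOn (cubeSet n) τ := by
    refine isZMapOn_of_pieces (continuousOn_pushDown K hρ.1.1) (κ := Option κ)
      (N := fun p => p.elim 1 N) (e := fun p => p.elim 0 e) fun x hx => ?_
    by_cases hxP : x ∈ zRange ρ
    · refine ⟨none, (hτid x hxP).trans (funext fun i => ?_)⟩
      simp [intAffineMap, Matrix.one_apply]
    · obtain ⟨p, hp⟩ := hτ x hx hxP
      exact ⟨some p, hp⟩
  have hmem : ∀ x ∈ cubeSet n, ρ (τ x) ∈ zRange ρ := fun x hx => ⟨τ x, hτc hx, rfl⟩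
  have hid : ∀ x ∈ zRange ρ, ρ (τ x) = x := fun x hx => by rw [hτid x hx, hρ.apply_eq hx]
  have hσ : IsZRetraction (ρ ∘ τ) :=
    ⟨hρ.1.comp hτZ hτc, hρ.2.1.comp hτc, fun x hx => hid _ (hmem x hx)⟩
  have hrange : zRange (ρ ∘ τ) = zRange ρ := by
    ext x
    constructor
    · rintro ⟨y, hy, rfl⟩
      exact hmem y hy
    · exact fun hx => ⟨x, hρ.zRange_subset hx, hid x hx⟩
  refine ⟨ρ ∘ τ, hσ, hrange, ?_, exists_isMVIsoFun_retAlg hρ hσ hrange⟩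
  refine Set.Subset.antisymm (fun Q hQ => ?_) ?_
  · rw [Set.mem_singleton_iff, ← hrange]
    refine eq_zRange_of_isZHomeoDomain hσ (hrange ▸ hcd) (κ := Fin k × κ)
      (N := fun p => M p.1 * N p.2)
      (c := fun p i => ∑ j, M p.1 i j * e p.2 j + b p.1 i) (fun p hp => hN p.2 ?_)
      (fun x hx hxP => ?_) hQ
    · rw [Matrix.det_mul] at hp
      exact isUnit_of_mul_isUnit_right hp
    · obtain ⟨j, hj⟩ := hτ x hx (hrange ▸ hxP)
      obtain ⟨i, hi⟩ := hMb (τ x) (hτc hx)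
      refine ⟨(i, j), ?_⟩
      rw [Function.comp_apply, hi, hj, intAffineMap_comp]
  · rintro _ rfl
    have := isZHomeoDomain_zRange hσ
    rwa [hrange] at this
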